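/- arXiv:1509.07714 — 3 statements merged into one kernel-verified Lean document; each statement's English description precedes it below -/
import Mathlib

section
/- The following four statements are equivalent: (1) −1 (mod n) lies in W_0; (2) (n₁−1)(n₂−1)/d² is odd; (3) n₁ ≡ d+1 (mod 2d) and n₂ ≡ d+1 (mod 2d); (4) n₁n₂ ≡ 1 (mod 2d). -/
theorem pow_eq_neg_one_iff_of_orderOf_eq {p : ℕ} (hp : p.Prime) (hodd : Odd p) {x : ZMod p}
    (hx : orderOf x = p - 1) (s : ℕ) :
    x ^ s = -1 ↔ ∃ k, Odd k ∧ 2 * s = (p - 1) * k := by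
  have := Fact.mk hp
  obtain ⟨m, hm⟩ := hodd
  have hm0 : 0 < m := by have := hp.two_le; omega
  have hpm : p - 1 = 2 * m := by omega
  rw [hpm] at hx ⊢
  have hxm : x ^ m = -1 := by
    have h1 : (x ^ m) ^ 2 = 1 := by rw [← pow_mul, mul_comm m 2, ← hx, pow_orderOf_eq_one]
    refine (by simpa using h1 : x ^ m = 1 ∨ x ^ m = -1).resolve_left fun h => ?_
    have := Nat.le_of_dvd hm0 (hx ▸ orderOf_dvd_of_pow_eq_one h)
    omega
  constructor
  · intro h
    have h1 : x ^ (s + m) = 1 := by rw [pow_add, h, hxm]; ring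
    obtain ⟨c, hc⟩ := hx ▸ orderOf_dvd_of_pow_eq_one h1
    obtain _ | c := c
    · omega
    · exact ⟨2 * c + 1, ⟨c, rfl⟩, by linarith⟩
  · rintro ⟨k, hk, h⟩
    have : s = m * k := by linarith
    rw [this, pow_mul, hxm, hk.neg_one_pow]

theorem neg_one_eq_natCast_pow_iff {m n : ℕ} (h : m.Coprime n) (g s : ℕ) :
    (-1 : ZMod (m * n)) = (g : ZMod (m * n)) ^ s ↔
      (g : ZMod m) ^ s = -1 ∧ (g : ZMod n) ^ s = -1 := by
  have key (r : ℕ) : (g : ZMod r) ^ s = -1 ↔ r ∣ g ^ s + 1 := by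
    rw [← ZMod.natCast_eq_zero_iff, eq_neg_iff_add_eq_zero]
    push_cast
    rfl
  rw [eq_comm, key, key, key]
  exact ⟨fun h' => ⟨dvd_of_mul_right_dvd h', dvd_of_mul_left_dvd h'⟩,
    fun h' => h.mul_dvd_of_dvd_of_dvd h'.1 h'.2⟩

theorem mul_add_one_modEq_iff_odd {d : ℕ} (hd : 0 < d) (a : ℕ) :
    d * a + 1 ≡ d + 1 [MOD 2 * d] ↔ Odd a := by
  have : d * a ≡ d * 1 [MOD d * 2] ↔ a ≡ 1 [MOD 2] :=
    ⟨Nat.ModEq.mul_left_cancel' hd.ne', Nat.ModEq.mul_left' d⟩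
  rw [mul_one] at this
  rw [Nat.odd_iff, mul_comm 2 d]
  exact ⟨fun h => this.1 (h.add_right_cancel' 1), fun h => (this.2 h).add_right 1⟩

theorem stmt_1
    (n₁ n₂ d n e g u : ℕ)
    (hp₁ : n₁.Prime) (hp₂ : n₂.Prime)
    (hodd₁ : Odd n₁) (hodd₂ : Odd n₂) (hne : n₁ ≠ n₂)
    (hd : d = Nat.gcd (n₁ - 1) (n₂ - 1))
    (hn : n = n₁ * n₂)
    (he : e = (n₁ - 1) * (n₂ - 1) / d)
    (hg₁ : orderOf (g : ZMod n₁) = n₁ - 1)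
    (hg₂ : orderOf (g : ZMod n₂) = n₂ - 1)
    (hu₁ : (u : ZMod n₁) = (g : ZMod n₁))
    (hu₂ : (u : ZMod n₂) = 1)
    (W : ℕ → Set (ZMod n))
    (hW : ∀ i, W i = {x | ∃ s < e, x = (g : ZMod n) ^ s * (u : ZMod n) ^ i}) :
    List.TFAE [(-1 : ZMod n) ∈ W 0,
      Odd ((n₁ - 1) * (n₂ - 1) / d ^ 2),
      (n₁ ≡ d + 1 [MOD 2 * d] ∧ n₂ ≡ d + 1 [MOD 2 * d]),
      n₁ * n₂ ≡ 1 [MOD 2 * d]] := by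
  have hn₁ := hp₁.two_le
  have hn₂ := hp₂.two_le
  have hd0 : 0 < d := hd ▸ Nat.gcd_pos_of_pos_left _ (by omega)
  have hd2 : 2 ∣ d := by
    rw [hd]
    exact Nat.dvd_gcd (hodd₁.tsub_odd odd_one).two_dvd (hodd₂.tsub_odd odd_one).two_dvd
  obtain ⟨c, hc⟩ := hd2
  obtain ⟨a, b, hab, ha, hb⟩ : ∃ a b, Nat.Coprime a b ∧ n₁ - 1 = d * a ∧ n₂ - 1 = d * b := by
    obtain ⟨a, b, hab, ha, hb⟩ := Nat.exists_coprime (n₁ - 1) (n₂ - 1)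
    exact ⟨a, b, hab, by rw [hd, mul_comm]; exact ha, by rw [hd, mul_comm]; exact hb⟩
  have ha0 : 0 < a := Nat.pos_of_ne_zero (by rintro rfl; omega)
  have hb0 : 0 < b := Nat.pos_of_ne_zero (by rintro rfl; omega)
  have hea : n₁ = d * a + 1 := by omega
  have heb : n₂ = d * b + 1 := by omega
  have hnot : ¬ (Even a ∧ Even b) := fun ⟨h, h'⟩ =>
    Nat.not_coprime_of_dvd_of_dvd one_lt_two h.two_dvd h'.two_dvd hab
  have hcop : n₁.Coprime n₂ := (Nat.coprime_primes hp₁ hp₂).2 hne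
  have h1 : (-1 : ZMod n) ∈ W 0 ↔ Odd a ∧ Odd b := by
    have he' : e = d * (a * b) := by
      rw [he, ha, hb, show d * a * (d * b) = d * (d * (a * b)) by ring,
        Nat.mul_div_cancel_left _ hd0]
    subst hn
    simp only [hW, Set.mem_ofPred_eq, pow_zero, mul_one, neg_one_eq_natCast_pow_iff hcop,
      pow_eq_neg_one_iff_of_orderOf_eq hp₁ hodd₁ hg₁,
      pow_eq_neg_one_iff_of_orderOf_eq hp₂ hodd₂ hg₂, ha, hb]
    constructor
    · rintro ⟨s, -, ⟨k, hk, hsk⟩, l, hl, hsl⟩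
      have hkl : a * k = b * l :=
        Nat.eq_of_mul_eq_mul_left hd0 (by rw [← mul_assoc, ← mul_assoc, ← hsk, hsl])
      have hpar : Odd (a * k) ↔ Odd (b * l) := by rw [hkl]
      rw [Nat.odd_mul, Nat.odd_mul] at hpar
      grind
    · rintro ⟨h, h'⟩
      refine ⟨c * (a * b), ?_, ⟨b, h', by rw [hc]; ring⟩, a, h, by rw [hc]; ring⟩
      rw [he']
      exact Nat.mul_lt_mul_of_pos_right (by omega) (by positivity)
  have h2 : Odd ((n₁ - 1) * (n₂ - 1) / d ^ 2) ↔ Odd a ∧ Odd b := by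
    rw [ha, hb, show d * a * (d * b) = d ^ 2 * (a * b) by ring,
      Nat.mul_div_cancel_left _ (by positivity), Nat.odd_mul]
  have h3 : (n₁ ≡ d + 1 [MOD 2 * d] ∧ n₂ ≡ d + 1 [MOD 2 * d]) ↔ Odd a ∧ Odd b := by
    rw [hea, heb, mul_add_one_modEq_iff_odd hd0, mul_add_one_modEq_iff_odd hd0]
  have h4 : n₁ * n₂ ≡ 1 [MOD 2 * d] ↔ Odd a ∧ Odd b := by
    have : n₁ * n₂ = d * (2 * (c * (a * b)) + (a + b)) + 1 := by
      rw [hea, heb, hc]; ring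
    rw [this, Nat.ModEq.comm, Nat.modEq_iff_dvd' (by omega), Nat.add_sub_cancel, mul_comm 2 d,
      Nat.mul_dvd_mul_iff_left hd0, Nat.dvd_add_right (dvd_mul_right _ _), ← even_iff_two_dvd,
      Nat.even_add]
    grind
  tfae_have 1 ↔ 2 := h1.trans h2.symm
  tfae_have 2 ↔ 3 := h2.trans h3.symm
  tfae_have 3 ↔ 4 := h3.trans h4.symm
  tfae_finish
end

section
/- Suppose (n₁−1)(n₂−1)/36 is even. Then for 0 < w ≤ n−1 the autocorrelation of the sequence λ satisfies: C_λ(w) = (n₂−n₁−3)/n if w mod n ∈ P; C_λ(w) = (n₁−n₂+1)/n if w mod n ∈ Q; and C_λ(w) = −1/n if w mod n is a unit of ℤ/nℤ. -/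
open Finset

section FiniteField

theorem exists_pow_eq_of_orderOf_eq {F : Type*} [Field F] [Fintype F] {g : F}
    (hg : orderOf g = Fintype.card F - 1) {x : F} (hx : x ≠ 0) : ∃ k : ℕ, g ^ k = x := by
  have hcard : 1 < Fintype.card F := Fintype.one_lt_card
  have hg0 : g ≠ 0 := by
    rintro rfl
    rw [orderOf_zero] at hg
    omega
  have htop : Subgroup.zpowers (Units.mk0 g hg0) = ⊤ := by
    apply Subgroup.eq_top_of_card_eq
    rw [Nat.card_zpowers, ← orderOf_units, Units.val_mk0, hg, Nat.card_units,
      Nat.card_eq_fintype_card]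
  have hmem : Units.mk0 x hx ∈ Subgroup.zpowers (Units.mk0 g hg0) := htop ▸ Subgroup.mem_top _
  obtain ⟨k, hk⟩ := mem_powers_iff_mem_zpowers.mpr hmem
  exact ⟨k, by simpa using congrArg Units.val hk⟩

variable {F : Type*} [Field F] [DecidableEq F]

/-- The indicator function of zero, with integer values. -/
def zeroIndicator (a : F) : ℤ := if a = 0 then 1 else 0

@[simp]
theorem zeroIndicator_zero : zeroIndicator (0 : F) = 1 := if_pos rfl

theorem zeroIndicator_of_ne {a : F} (ha : a ≠ 0) : zeroIndicator a = 0 := if_neg ha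

variable [Fintype F]

theorem sum_zeroIndicator_add (w : F) : ∑ a : F, zeroIndicator (a + w) = 1 := by
  simp [zeroIndicator, add_eq_zero_iff_eq_neg]

theorem sum_zeroIndicator : ∑ a : F, zeroIndicator a = 1 := by
  simp [zeroIndicator]

theorem sum_mul_zeroIndicator (f : F → ℤ) : ∑ a : F, f a * zeroIndicator a = f 0 := by
  simp [zeroIndicator]

theorem sum_zeroIndicator_add_mul (f : F → ℤ) (w : F) :
    ∑ a : F, zeroIndicator (a + w) * f a = f (-w) := by
  simp [zeroIndicator, add_eq_zero_iff_eq_neg]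

theorem sum_quadraticChar_add (hF : ringChar F ≠ 2) (w : F) :
    ∑ a : F, quadraticChar F (a + w) = 0 := by
  exact (Equiv.sum_comp (Equiv.addRight w) (quadraticChar F)).trans (quadraticChar_sum_zero hF)

theorem sum_quadraticChar_sq : ∑ a : F, quadraticChar F a * quadraticChar F a =
    (Fintype.card F : ℤ) - 1 := by
  have h (a : F) : quadraticChar F a * quadraticChar F a = 1 - zeroIndicator a := by
    by_cases ha : a = 0
    · simp [ha]
    · rw [← sq, quadraticChar_sq_one ha, zeroIndicator_of_ne ha, sub_zero]
  simp only [h, sum_sub_distrib, sum_zeroIndicator, sum_const, card_univ, nsmul_eq_mul, mul_one]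

theorem sum_quadraticChar_add_mul_of_ne_zero (hF : ringChar F ≠ 2) {w : F} (hw : w ≠ 0) :
    ∑ a : F, quadraticChar F (a + w) * quadraticChar F a = -1 := by
  have hJ := jacobiSum_nontrivial_inv (quadraticChar_ne_one hF)
  rw [(quadraticChar_isQuadratic F).inv, jacobiSum] at hJ
  have hneg : quadraticChar F (-1) ^ 2 = 1 := quadraticChar_sq_one (neg_ne_zero.mpr one_ne_zero)
  have hw2 := quadraticChar_sq_one hw
  rw [← Equiv.sum_comp (Equiv.mulLeft₀ (-w) (neg_ne_zero.mpr hw))]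
  have h (x : F) : quadraticChar F (Equiv.mulLeft₀ (-w) (neg_ne_zero.mpr hw) x + w) *
      quadraticChar F (Equiv.mulLeft₀ (-w) (neg_ne_zero.mpr hw) x) =
      quadraticChar F (-1) * (quadraticChar F x * quadraticChar F (1 - x)) := by
    have h₁ : Equiv.mulLeft₀ (-w) (neg_ne_zero.mpr hw) x + w = w * (1 - x) := by
      rw [Equiv.mulLeft₀_apply]; ring
    have h₂ : Equiv.mulLeft₀ (-w) (neg_ne_zero.mpr hw) x = w * (-1) * x := by
      rw [Equiv.mulLeft₀_apply]; ring
    rw [h₁, h₂, map_mul, map_mul, map_mul]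
    linear_combination quadraticChar F (-1) * quadraticChar F x * quadraticChar F (1 - x) * hw2
  rw [sum_congr rfl fun x _ ↦ h x, ← mul_sum, hJ]
  linear_combination -hneg

theorem sum_quadraticChar_add_mul (hF : ringChar F ≠ 2) (w : F) :
    ∑ a : F, quadraticChar F (a + w) * quadraticChar F a =
      Fintype.card F * zeroIndicator w - 1 := by
  by_cases hw : w = 0
  · simp only [hw, add_zero, sum_quadraticChar_sq, zeroIndicator_zero, mul_one]
  · rw [zeroIndicator_of_ne hw, sum_quadraticChar_add_mul_of_ne_zero hF hw]
    ring

theorem sum_affine_quadraticChar (hF : ringChar F ≠ 2) (w : F) (x y z x' y' z' : ℤ) :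
    ∑ a : F, (x * quadraticChar F (a + w) + y + z * zeroIndicator (a + w)) *
        (x' * quadraticChar F a + y' + z' * zeroIndicator a) =
      x * x' * (Fintype.card F * zeroIndicator w - 1) + y * y' * Fintype.card F +
        z * z' * zeroIndicator w + x * z' * quadraticChar F w + z * x' * quadraticChar F (-w) +
        y * z' + z * y' := by
  have h (a : F) : (x * quadraticChar F (a + w) + y + z * zeroIndicator (a + w)) *
        (x' * quadraticChar F a + y' + z' * zeroIndicator a) =
      x * x' * (quadraticChar F (a + w) * quadraticChar F a) + x * y' * quadraticChar F (a + w) +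
      x * z' * (quadraticChar F (a + w) * zeroIndicator a) +
      y * x' * quadraticChar F a + y * y' * 1 + y * z' * zeroIndicator a +
      z * x' * (zeroIndicator (a + w) * quadraticChar F a) +
      z * y' * zeroIndicator (a + w) +
      z * z' * (zeroIndicator (a + w) * zeroIndicator a) := by ring
  rw [sum_congr rfl fun a _ ↦ h a]
  simp only [sum_add_distrib, ← mul_sum, sum_quadraticChar_add_mul hF, sum_quadraticChar_add hF,
    quadraticChar_sum_zero hF, sum_zeroIndicator_add, sum_zeroIndicator, sum_zeroIndicator_add_mul,
    sum_mul_zeroIndicator (fun a ↦ quadraticChar F (a + w)),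
    sum_mul_zeroIndicator (fun a ↦ zeroIndicator (a + w)), zero_add]
  simp only [sum_const, card_univ, nsmul_eq_mul, mul_one]
  ring

theorem quadraticChar_eq_neg_one_of_orderOf_eq (hF : ringChar F ≠ 2) {g : F}
    (hg : orderOf g = Fintype.card F - 1) : quadraticChar F g = -1 := by
  obtain ⟨a, ha⟩ := quadraticChar_exists_neg_one hF
  have ha0 : a ≠ 0 := by
    rintro rfl
    simp at ha
  obtain ⟨k, rfl⟩ := exists_pow_eq_of_orderOf_eq hg ha0
  by_cases hg0 : g = 0
  · subst hg0
    rcases k.eq_zero_or_pos with rfl | hk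
    · simp at ha
    · simp [hk.ne'] at ha
  · rcases quadraticChar_dichotomy hg0 with h | h
    · norm_num [h, -quadraticChar_apply] at ha
    · exact h

end FiniteField

section TwoPrime

variable {F₁ F₂ : Type*} [Field F₁] [Fintype F₁] [DecidableEq F₁]
  [Field F₂] [Fintype F₂] [DecidableEq F₂]

/-- The `±1`-valued two-prime sequence: the product of the quadratic characters on units,
`-1` at `(0, b)` with `b ≠ 0`, and `1` at `(a, 0)`. -/
def twoPrimeSign (x : F₁ × F₂) : ℤ :=
  quadraticChar F₁ x.1 * quadraticChar F₂ x.2 + -zeroIndicator x.1 +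
    (1 + zeroIndicator x.1) * zeroIndicator x.2

theorem sum_twoPrimeSign_add_mul (h₁ : ringChar F₁ ≠ 2) (h₂ : ringChar F₂ ≠ 2) (w : F₁ × F₂) :
    ∑ x : F₁ × F₂, twoPrimeSign (x + w) * twoPrimeSign x =
      (Fintype.card F₁ * zeroIndicator w.1 - 1) * (Fintype.card F₂ * zeroIndicator w.2 - 1) +
        Fintype.card F₂ * zeroIndicator w.1 +
        (Fintype.card F₁ + 2 + zeroIndicator w.1) * zeroIndicator w.2 +
        quadraticChar F₁ w.1 * quadraticChar F₂ w.2 +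
        quadraticChar F₁ (-w.1) * quadraticChar F₂ (-w.2) - 2 * (1 + zeroIndicator w.1) := by
  have inner (a : F₁) := sum_affine_quadraticChar h₂ w.2 (quadraticChar F₁ (a + w.1))
    (-zeroIndicator (a + w.1)) (1 + zeroIndicator (a + w.1)) (quadraticChar F₁ a)
    (-zeroIndicator a) (1 + zeroIndicator a)
  have expand (a : F₁) (A B C D N : ℤ) :
      quadraticChar F₁ (a + w.1) * quadraticChar F₁ a * A +
        -zeroIndicator (a + w.1) * -zeroIndicator a * N +
        (1 + zeroIndicator (a + w.1)) * (1 + zeroIndicator a) * B +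
        quadraticChar F₁ (a + w.1) * (1 + zeroIndicator a) * C +
        (1 + zeroIndicator (a + w.1)) * quadraticChar F₁ a * D +
        -zeroIndicator (a + w.1) * (1 + zeroIndicator a) +
        (1 + zeroIndicator (a + w.1)) * -zeroIndicator a =
      A * (quadraticChar F₁ (a + w.1) * quadraticChar F₁ a) +
        (N + B - 2) * (zeroIndicator (a + w.1) * zeroIndicator a) +
        B * 1 + (B - 1) * zeroIndicator (a + w.1) + (B - 1) * zeroIndicator a +
        C * quadraticChar F₁ (a + w.1) + C * (quadraticChar F₁ (a + w.1) * zeroIndicator a) +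
        D * quadraticChar F₁ a + D * (zeroIndicator (a + w.1) * quadraticChar F₁ a) := by ring
  simp only [Fintype.sum_prod_type, twoPrimeSign, Prod.fst_add, Prod.snd_add, inner, expand,
    sum_add_distrib, ← mul_sum, sum_quadraticChar_add_mul h₁, sum_quadraticChar_add h₁,
    quadraticChar_sum_zero h₁, sum_zeroIndicator_add, sum_zeroIndicator, sum_zeroIndicator_add_mul,
    sum_mul_zeroIndicator (fun a ↦ quadraticChar F₁ (a + w.1)),
    sum_mul_zeroIndicator (fun a ↦ zeroIndicator (a + w.1)), zero_add]
  simp only [sum_const, card_univ, nsmul_eq_mul, mul_one]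
  ring

end TwoPrime

section Residues

theorem ZMod.natCast_mem_multiples_iff {p q n : ℕ} (hq : q.Prime) (hpq : p.Coprime q)
    (hn : n = p * q) (i : ℕ) :
    (∃ k : ℕ, 1 ≤ k ∧ k ≤ q - 1 ∧ (i : ZMod n) = ((k * p : ℕ) : ZMod n)) ↔
      (i : ZMod p) = 0 ∧ (i : ZMod q) ≠ 0 := by
  simp only [ZMod.natCast_eq_natCast_iff, Ne, ZMod.natCast_eq_zero_iff]
  subst hn
  constructor
  · rintro ⟨k, hk₁, hk₂, h⟩
    refine ⟨(h.of_mul_right q).dvd_iff dvd_rfl |>.mpr (Nat.dvd_mul_left p k), fun hi ↦ ?_⟩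
    have hkp : q ∣ k * p := ((h.of_mul_left p).dvd_iff dvd_rfl).mp hi
    have := Nat.le_of_dvd hk₁ (hpq.symm.dvd_of_dvd_mul_right hkp)
    have := hq.pos
    omega
  · rintro ⟨⟨m, rfl⟩, hi⟩
    have hm : ¬ q ∣ m := fun h ↦ hi (h.mul_left p)
    refine ⟨m % q, Nat.pos_of_ne_zero fun h ↦ hm (Nat.dvd_of_mod_eq_zero h),
      Nat.le_sub_one_of_lt (Nat.mod_lt m hq.pos), ?_⟩
    rw [mul_comm (m % q) p]
    exact (Nat.ModEq.mul_left' p (Nat.mod_modEq m q)).symm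

theorem sum_range_mul_eq_sum_zmod_prod {M : Type*} [AddCommMonoid M] {p q : ℕ} [NeZero p] [NeZero q]
    (hpq : p.Coprime q) (f : ZMod p × ZMod q → M) :
    ∑ i ∈ range (p * q), f ((i : ZMod p), (i : ZMod q)) = ∑ x, f x := by
  refine sum_nbij (fun i : ℕ ↦ ((i : ZMod p), (i : ZMod q))) (fun _ _ ↦ mem_univ _) ?_ ?_
    fun _ _ ↦ rfl
  · intro i hi j hj hij
    simp only [Prod.mk.injEq, ZMod.natCast_eq_natCast_iff] at hij
    exact Nat.ModEq.eq_of_lt_of_lt ((Nat.modEq_and_modEq_iff_modEq_mul hpq).mp hij)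
      (mem_range.mp hi) (mem_range.mp hj)
  · rintro ⟨a, b⟩ -
    obtain ⟨hk₁, hk₂⟩ := (Nat.chineseRemainder hpq a.val b.val).2
    refine ⟨_, mem_coe.mpr (mem_range.mpr
      (Nat.chineseRemainder_lt_mul hpq a.val b.val (NeZero.ne p) (NeZero.ne q))), ?_⟩
    rw [← ZMod.natCast_eq_natCast_iff] at hk₁ hk₂
    simp [hk₁, hk₂]

variable {p q : ℕ} [Fact p.Prime] [Fact q.Prime]

theorem ZMod.quadraticChar_primitiveRoot (hp : Odd p) {g : ℕ}
    (hg : orderOf (g : ZMod p) = p - 1) : quadraticChar (ZMod p) g = -1 := by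
  refine quadraticChar_eq_neg_one_of_orderOf_eq ?_ (by rwa [ZMod.card])
  rw [ZMod.ringChar_zmod_n]
  rintro rfl
  exact absurd hp (by decide)

/-- The odd-index Whiteman classes of order six are cut out by the product of the quadratic
characters. -/
theorem ZMod.natCast_mem_odd_whitemanClass_iff {n e g u : ℕ} (hp : Odd p) (hq : Odd q)
    (hpq : p.Coprime q) (h6 : Nat.gcd (p - 1) (q - 1) = 6) (hn : n = p * q)
    (he : e = (p - 1) * (q - 1) / 6)
    (hgp : orderOf (g : ZMod p) = p - 1) (hgq : orderOf (g : ZMod q) = q - 1)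
    (hup : (u : ZMod p) = g) (huq : (u : ZMod q) = 1) (i : ℕ) :
    (∃ j, (j = 1 ∨ j = 3 ∨ j = 5) ∧ ∃ s < e, (i : ZMod n) = (g : ZMod n) ^ s * (u : ZMod n) ^ j) ↔
      quadraticChar (ZMod p) i * quadraticChar (ZMod q) i = -1 := by
  have hχp := ZMod.quadraticChar_primitiveRoot hp hgp
  have hχq := ZMod.quadraticChar_primitiveRoot hq hgq
  have key (s j : ℕ) : (i : ZMod n) = (g : ZMod n) ^ s * (u : ZMod n) ^ j ↔
      (i : ZMod p) = (g : ZMod p) ^ (s + j) ∧ (i : ZMod q) = (g : ZMod q) ^ s := by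
    have h := (ZMod.natCast_eq_natCast_iff i (g ^ s * u ^ j) n).trans
      (hn ▸ (Nat.modEq_and_modEq_iff_modEq_mul hpq).symm)
    rw [← ZMod.natCast_eq_natCast_iff, ← ZMod.natCast_eq_natCast_iff] at h
    simpa [hup, huq, pow_add] using h
  simp only [key]
  constructor
  · rintro ⟨j, hj, s, -, h₁, h₂⟩
    rw [h₁, h₂, map_pow, map_pow, hχp, hχq, pow_add, mul_right_comm, ← mul_pow]
    rcases hj with rfl | rfl | rfl <;> norm_num
  · intro h
    have hi₁ : (i : ZMod p) ≠ 0 := by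
      intro h0
      rw [h0, MulChar.map_zero, zero_mul] at h
      norm_num at h
    have hi₂ : (i : ZMod q) ≠ 0 := by
      intro h0
      rw [h0, MulChar.map_zero, mul_zero] at h
      norm_num at h
    obtain ⟨a, ha⟩ := exists_pow_eq_of_orderOf_eq (hgp.trans (by rw [ZMod.card])) hi₁
    obtain ⟨b, hb⟩ := exists_pow_eq_of_orderOf_eq (hgq.trans (by rw [ZMod.card])) hi₂
    rw [← ha, ← hb, map_pow, map_pow, hχp, hχq, ← pow_add, neg_one_pow_eq_neg_one_iff_odd
      (by norm_num), Nat.odd_iff] at h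
    obtain ⟨j, hj, hjab⟩ : ∃ j, (j = 1 ∨ j = 3 ∨ j = 5) ∧ b + j ≡ a [MOD 6] := by
      refine ⟨(a + 5 * b) % 6, by omega, ?_⟩
      unfold Nat.ModEq
      omega
    have hp1 : p - 1 ≠ 0 := by have := (Fact.out : p.Prime).two_le; omega
    have hq1 : q - 1 ≠ 0 := by have := (Fact.out : q.Prime).two_le; omega
    have hle : j ≤ (p - 1) * j := Nat.le_mul_of_pos_left j (Nat.pos_of_ne_zero hp1)
    have hab : a + ((p - 1) * j - j) ≡ b [MOD Nat.gcd (p - 1) (q - 1)] := by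
      have hdvd : 6 ∣ (p - 1) * j := (h6 ▸ Nat.gcd_dvd_left (p - 1) (q - 1)).mul_right j
      rw [h6]
      unfold Nat.ModEq at hjab ⊢
      omega
    obtain ⟨hs₁, hs₂⟩ := (Nat.chineseRemainder' hab).2
    have hlt := Nat.chineseRemainder'_lt_lcm hab hp1 hq1
    rw [Nat.lcm, h6, ← he] at hlt
    refine ⟨j, hj, _, hlt, ?_, ?_⟩
    · have hsj := hs₁.add_right j
      rw [add_assoc, Nat.sub_add_cancel hle] at hsj
      rw [← ha, pow_eq_pow_of_modEq (hsj.trans (b := a + (p - 1) * j) (c := a) (by simp [Nat.ModEq]))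
        (hgp ▸ pow_orderOf_eq_one (g : ZMod p))]
    · rw [← hb, pow_eq_pow_of_modEq hs₂ (hgq ▸ pow_orderOf_eq_one (g : ZMod q))]

theorem quadraticChar_neg_one_mul_quadraticChar_neg_one (hp : Odd p) (hq : Odd q)
    (h6 : Nat.gcd (p - 1) (q - 1) = 6) (heven : Even ((p - 1) * (q - 1) / 36)) :
    quadraticChar (ZMod p) (-1) * quadraticChar (ZMod q) (-1) = -1 := by
  have hp2 := Nat.odd_iff.mp hp
  have hq2 := Nat.odd_iff.mp hq
  obtain ⟨a, ha⟩ : 6 ∣ p - 1 := h6 ▸ Nat.gcd_dvd_left _ _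
  obtain ⟨b, hb⟩ : 6 ∣ q - 1 := h6 ▸ Nat.gcd_dvd_right _ _
  rw [ha, hb, Nat.gcd_mul_left] at h6
  have hcop : ¬ (Even a ∧ Even b) := fun h ↦ by
    have := Nat.dvd_gcd h.1.two_dvd h.2.two_dvd
    omega
  have hab : Even (a * b) := by
    rwa [ha, hb, mul_mul_mul_comm, show 6 * 6 = 36 from rfl,
      Nat.mul_div_cancel_left _ (by norm_num)] at heven
  rw [Nat.even_mul] at hab
  rw [quadraticChar_neg_one (by rw [ZMod.ringChar_zmod_n]; rintro rfl; omega),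
    quadraticChar_neg_one (by rw [ZMod.ringChar_zmod_n]; rintro rfl; omega), ZMod.card, ZMod.card,
    ZMod.χ₄_eq_neg_one_pow hp2, ZMod.χ₄_eq_neg_one_pow hq2, ← pow_add]
  apply Odd.neg_one_pow
  rw [Nat.even_iff, Nat.even_iff] at hcop hab
  rw [Nat.odd_iff]
  omega

end Residues


theorem stmt_7
    (n₁ n₂ n e g u : ℕ)
    (hp₁ : n₁.Prime) (hp₂ : n₂.Prime)
    (hodd₁ : Odd n₁) (hodd₂ : Odd n₂) (hne : n₁ ≠ n₂)
    (h6 : Nat.gcd (n₁ - 1) (n₂ - 1) = 6)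
    (hn : n = n₁ * n₂)
    (he : e = (n₁ - 1) * (n₂ - 1) / 6)
    (hg₁ : orderOf (g : ZMod n₁) = n₁ - 1)
    (hg₂ : orderOf (g : ZMod n₂) = n₂ - 1)
    (hu₁ : (u : ZMod n₁) = (g : ZMod n₁))
    (hu₂ : (u : ZMod n₂) = 1)
    (W : ℕ → Set (ZMod n))
    (hW : ∀ i, W i = {x | ∃ s < e, x = (g : ZMod n) ^ s * (u : ZMod n) ^ i})
    (P Q : Set (ZMod n))
    (hP : P = {x | ∃ k : ℕ, 1 ≤ k ∧ k ≤ n₂ - 1 ∧ x = ((k * n₁ : ℕ) : ZMod n)})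
    (hQ : Q = {x | ∃ k : ℕ, 1 ≤ k ∧ k ≤ n₁ - 1 ∧ x = ((k * n₂ : ℕ) : ZMod n)})
    (C₁ : Set (ZMod n)) (hC₁ : C₁ = P ∪ W 1 ∪ W 3 ∪ W 5)
    (lam : ℕ → ℤ)
    (hlam : ∀ i : ℕ, ((i : ZMod n) ∈ C₁ → lam i = 1) ∧ ((i : ZMod n) ∉ C₁ → lam i = 0))
    (heven : Even ((n₁ - 1) * (n₂ - 1) / 36)) :
    ∀ w : ℕ, 0 < w → w ≤ n - 1 →
      (((w : ZMod n) ∈ P →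
        (1 / (n : ℚ)) * ∑ i ∈ Finset.range n, (-1 : ℚ) ^ (lam (i + w) + lam i)
          = ((n₂ : ℚ) - n₁ - 3) / n) ∧
      ((w : ZMod n) ∈ Q →
        (1 / (n : ℚ)) * ∑ i ∈ Finset.range n, (-1 : ℚ) ^ (lam (i + w) + lam i)
          = ((n₁ : ℚ) - n₂ + 1) / n) ∧
      (IsUnit (w : ZMod n) →
        (1 / (n : ℚ)) * ∑ i ∈ Finset.range n, (-1 : ℚ) ^ (lam (i + w) + lam i)
          = -1 / n)) := by
  have := Fact.mk hp₁
  have := Fact.mk hp₂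
  have hcop : n₁.Coprime n₂ := (Nat.coprime_primes hp₁ hp₂).mpr hne
  have hchar₁ : ringChar (ZMod n₁) ≠ 2 := by
    rw [ZMod.ringChar_zmod_n]; rintro rfl; exact absurd hodd₁ (by decide)
  have hchar₂ : ringChar (ZMod n₂) ≠ 2 := by
    rw [ZMod.ringChar_zmod_n]; rintro rfl; exact absurd hodd₂ (by decide)
  have hmemP (i : ℕ) : (i : ZMod n) ∈ P ↔ (i : ZMod n₁) = 0 ∧ (i : ZMod n₂) ≠ 0 := by
    rw [hP]; exact ZMod.natCast_mem_multiples_iff hp₂ hcop hn i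
  have hmemQ (i : ℕ) : (i : ZMod n) ∈ Q ↔ (i : ZMod n₂) = 0 ∧ (i : ZMod n₁) ≠ 0 := by
    rw [hQ]; exact ZMod.natCast_mem_multiples_iff hp₁ hcop.symm (hn.trans (mul_comm _ _)) i
  have hmemC (i : ℕ) : (i : ZMod n) ∈ C₁ ↔ ((i : ZMod n₁) = 0 ∧ (i : ZMod n₂) ≠ 0) ∨
      quadraticChar (ZMod n₁) i * quadraticChar (ZMod n₂) i = -1 := by
    rw [← hmemP, ← ZMod.natCast_mem_odd_whitemanClass_iff hodd₁ hodd₂ hcop h6 hn he hg₁ hg₂ hu₁ hu₂,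
      hC₁]
    simp [hW, or_assoc, or_and_right, exists_or]
  have hsign (i : ℕ) :
      (-1 : ℚ) ^ lam i = (twoPrimeSign ((i : ZMod n₁), (i : ZMod n₂)) : ℤ) := by
    obtain ⟨hl₁, hl₀⟩ := hlam i
    rw [hmemC] at hl₁ hl₀
    by_cases h₁ : (i : ZMod n₁) = 0
    · by_cases h₂ : (i : ZMod n₂) = 0
      · simp [hl₀ (by simp [h₁, h₂]), twoPrimeSign, h₁, h₂]
      · simp [hl₁ (.inl ⟨h₁, h₂⟩), twoPrimeSign, h₁, zeroIndicator_of_ne h₂]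
    · by_cases h₂ : (i : ZMod n₂) = 0
      · simp [hl₀ (by simp [h₁, h₂]), twoPrimeSign, zeroIndicator_of_ne h₁, h₂]
      · have hf : twoPrimeSign ((i : ZMod n₁), (i : ZMod n₂)) =
            quadraticChar (ZMod n₁) i * quadraticChar (ZMod n₂) i := by
          simp [twoPrimeSign, zeroIndicator_of_ne h₁, zeroIndicator_of_ne h₂]
        rw [hf]
        rcases quadraticChar_dichotomy h₁ with ha | ha <;>
          rcases quadraticChar_dichotomy h₂ with hb | hb <;>
          rw [ha, hb] at hl₁ hl₀ ⊢ <;> norm_num [h₁] at hl₁ hl₀ <;> simp [hl₁, hl₀]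
  intro w hw hwn
  have hsum := sum_twoPrimeSign_add_mul hchar₁ hchar₂ ((w : ZMod n₁), (w : ZMod n₂))
  have hcorr : ∑ i ∈ range n, (-1 : ℚ) ^ (lam (i + w) + lam i) =
      (∑ x : ZMod n₁ × ZMod n₂,
        twoPrimeSign (x + ((w : ZMod n₁), (w : ZMod n₂))) * twoPrimeSign x : ℤ) := by
    rw [hn, ← sum_range_mul_eq_sum_zmod_prod hcop, Int.cast_sum]
    refine sum_congr rfl fun i _ ↦ ?_
    rw [zpow_add₀ (by norm_num), hsign, hsign]
    simp
  simp only [hcorr, hsum, ZMod.card]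
  refine ⟨fun hwP ↦ ?_, fun hwQ ↦ ?_, fun hunit ↦ ?_⟩
  · obtain ⟨h₁, h₂⟩ := (hmemP w).mp hwP
    simp only [h₁, zeroIndicator_zero, zeroIndicator_of_ne h₂, MulChar.map_zero, neg_zero]
    push_cast
    ring
  · obtain ⟨h₂, h₁⟩ := (hmemQ w).mp hwQ
    simp only [h₂, zeroIndicator_zero, zeroIndicator_of_ne h₁, MulChar.map_zero, neg_zero]
    push_cast
    ring
  · have hwcop := (ZMod.isUnit_iff_coprime w n).mp hunit
    rw [hn] at hwcop
    have h₁ : (w : ZMod n₁) ≠ 0 :=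
      ((ZMod.isUnit_iff_coprime w n₁).mpr hwcop.coprime_mul_right_right).ne_zero
    have h₂ : (w : ZMod n₂) ≠ 0 :=
      ((ZMod.isUnit_iff_coprime w n₂).mpr hwcop.coprime_mul_left_right).ne_zero
    have hneg : quadraticChar (ZMod n₁) (-w) * quadraticChar (ZMod n₂) (-w) =
        -(quadraticChar (ZMod n₁) w * quadraticChar (ZMod n₂) w) := by
      rw [neg_eq_neg_one_mul (w : ZMod n₁), neg_eq_neg_one_mul (w : ZMod n₂), map_mul, map_mul,
        mul_mul_mul_comm, quadraticChar_neg_one_mul_quadraticChar_neg_one hodd₁ hodd₂ h6 heven,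
        neg_one_mul]
    simp only [zeroIndicator_of_ne h₁, zeroIndicator_of_ne h₂, hneg]
    push_cast
    ring
end

section
/- For every t ∈ ℤ/nℤ: Λ(β^t) equals the image of the integer −(n₁+1)/2 in GF(q^m) if t ∈ P; Λ(β^t) equals the image of (n₂−1)/2 if t ∈ Q; Λ(β^t) = Λ(β) if t ∈ D₀; and Λ(β^t) = −(Λ(β)+1) if t ∈ D₁. -/
open Finset in
/-- The partial Gauss sum of `φ (a * t)` over the `a` with quadratic character `ε`. -/
def quadraticPeriod {K F : Type*} [Field K] [Fintype K] [DecidableEq K] [Field F]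
    (φ : AddChar K F) (ε : ℤ) (t : K) : F :=
  ∑ a with quadraticChar K a = ε, φ (a * t)

section QuadraticPeriod

open Finset

variable {K F : Type*} [Field K] [Fintype K] [DecidableEq K] [Field F] (φ : AddChar K F)

theorem quadraticPeriod_of_ne_zero (ε : ℤ) {t : K} (ht : t ≠ 0) :
    quadraticPeriod φ ε t = quadraticPeriod φ (ε * quadraticChar K t) 1 := by
  have ht2 : quadraticChar K t * quadraticChar K t = 1 := by
    rw [← sq, quadraticChar_sq_one ht]
  unfold quadraticPeriod
  refine Finset.sum_bij' (fun a _ => a * t) (fun a _ => a * t⁻¹) ?_ ?_ ?_ ?_ ?_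
  · intro a h
    simp only [mem_filter, mem_univ, true_and] at h ⊢
    rw [map_mul, h]
  · intro a h
    simp only [mem_filter, mem_univ, true_and] at h ⊢
    have h1 : quadraticChar K (a * t⁻¹) * quadraticChar K t = ε * quadraticChar K t := by
      rw [← map_mul, inv_mul_cancel_right₀ ht, h]
    exact mul_right_cancel₀ (fun h0 => by simp [h0] at ht2) h1
  · intro a _
    exact mul_inv_cancel_right₀ ht a
  · intro a _
    exact inv_mul_cancel_right₀ ht a
  · intro a _
    simp

theorem sum_filter_quadraticChar_add (f : K → F) :
    ∑ a with quadraticChar K a = 1, f a + ∑ a with quadraticChar K a = -1, f a =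
      ∑ a with a ≠ 0, f a := by
  rw [← sum_union]
  · congr 1
    ext a
    simp only [mem_union, mem_filter, mem_univ, true_and]
    constructor
    · rintro (h | h) rfl <;> simp at h
    · exact quadraticChar_dichotomy
  · rw [disjoint_filter]
    intro a _ h h'
    rw [h] at h'
    norm_num at h'

theorem quadraticPeriod_one_add_neg_one (hφ : φ ≠ 1) {t : K} (ht : t ≠ 0) :
    quadraticPeriod φ 1 t + quadraticPeriod φ (-1) t = -1 := by
  unfold quadraticPeriod
  rw [sum_filter_quadraticChar_add (fun a => φ (a * t)), filter_ne',
    sum_erase_eq_sub (mem_univ 0)]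
  have : ∑ a, φ (a * t) = 0 := by
    rw [← AddChar.sum_eq_zero_of_ne_one hφ]
    exact Fintype.sum_equiv (Equiv.mulRight₀ t ht) _ _ (fun a => rfl)
  simp [this]

theorem card_filter_quadraticChar (hK : ringChar K ≠ 2) {ε : ℤ} (hε : ε = 1 ∨ ε = -1) :
    #{a : K | quadraticChar K a = ε} = (Fintype.card K - 1) / 2 := by
  have hsum : (#{a : K | quadraticChar K a = 1} : ℚ) + #{a : K | quadraticChar K a = -1} =
      Fintype.card K - 1 := by
    have := sum_filter_quadraticChar_add (K := K) (fun _ => (1 : ℚ))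
    rw [filter_ne', sum_erase_eq_sub (mem_univ 0)] at this
    simpa using this
  have heq : #{a : K | quadraticChar K a = 1} = #{a : K | quadraticChar K a = -1} := by
    obtain ⟨t, ht⟩ := quadraticChar_exists_neg_one hK
    have ht0 : t ≠ 0 := by rintro rfl; simp at ht
    have := quadraticPeriod_of_ne_zero (1 : AddChar K ℚ) 1 ht0
    rw [ht] at this
    simpa [quadraticPeriod] using this
  have hcard := Fintype.card_pos (α := K)
  have hnat : #{a : K | quadraticChar K a = 1} + #{a : K | quadraticChar K a = -1} + 1 =
      Fintype.card K := by
    have : (#{a : K | quadraticChar K a = 1} : ℚ) + #{a : K | quadraticChar K a = -1} + 1 =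
      Fintype.card K := by rw [hsum]; ring
    exact_mod_cast this
  rcases hε with rfl | rfl <;> omega

theorem quadraticPeriod_zero (hK : ringChar K ≠ 2) {ε : ℤ} (hε : ε = 1 ∨ ε = -1) :
    quadraticPeriod φ ε 0 = ((Fintype.card K - 1) / 2 : ℕ) := by
  rw [← card_filter_quadraticChar hK hε]
  simp [quadraticPeriod]

end QuadraticPeriod

section WhitemanSum

open Finset

variable {K L F : Type*} [Field K] [Fintype K] [DecidableEq K] [Field L] [Fintype L]
  [DecidableEq L] [Field F]

/-- The image of the defining set `P ∪ W₁ ∪ W₃ ∪ W₅` under the Chinese remainder isomorphism. -/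
def whitemanSet (K L : Type*) [Field K] [Fintype K] [DecidableEq K] [Field L] [Fintype L]
    [DecidableEq L] : Finset (K × L) :=
  {x | x.1 = 0 ∧ x.2 ≠ 0 ∨ quadraticChar K x.1 * quadraticChar L x.2 = -1}

/-- The exponential sum over `whitemanSet K L`. -/
def whitemanSum (φ : AddChar K F) (ψ : AddChar L F) (s : K) (t : L) : F :=
  ∑ x ∈ whitemanSet K L, φ (x.1 * s) * ψ (x.2 * t)

theorem quadraticChar_mul_eq_neg_one_iff (a : K) (b : L) :
    quadraticChar K a * quadraticChar L b = -1 ↔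
      quadraticChar K a = 1 ∧ quadraticChar L b = -1 ∨
        quadraticChar K a = -1 ∧ quadraticChar L b = 1 := by
  rcases eq_or_ne a 0 with rfl | ha
  · simp
  rcases eq_or_ne b 0 with rfl | hb
  · simp
  rcases quadraticChar_dichotomy ha with h | h <;>
    rcases quadraticChar_dichotomy hb with h' | h' <;> simp [h, h']

theorem quadraticChar_mul_eq_one_iff (a : K) (b : L) :
    quadraticChar K a * quadraticChar L b = 1 ↔
      quadraticChar K a = 1 ∧ quadraticChar L b = 1 ∨
        quadraticChar K a = -1 ∧ quadraticChar L b = -1 := by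
  rcases eq_or_ne a 0 with rfl | ha
  · simp
  rcases eq_or_ne b 0 with rfl | hb
  · simp
  rcases quadraticChar_dichotomy ha with h | h <;>
    rcases quadraticChar_dichotomy hb with h' | h' <;> simp [h, h']

theorem whitemanSet_eq : whitemanSet K L =
    ({0} : Finset K) ×ˢ univ.filter (fun b : L => b ≠ 0) ∪
      (univ.filter (fun a : K => quadraticChar K a = 1) ×ˢ
          univ.filter (fun b : L => quadraticChar L b = -1) ∪
        univ.filter (fun a : K => quadraticChar K a = -1) ×ˢ
          univ.filter (fun b : L => quadraticChar L b = 1)) := by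
  ext ⟨a, b⟩
  simp only [whitemanSet, quadraticChar_mul_eq_neg_one_iff, mem_union, mem_product,
    mem_singleton, mem_filter, mem_univ, true_and]

theorem whitemanSum_eq (φ : AddChar K F) (ψ : AddChar L F) (s : K) (t : L) :
    whitemanSum φ ψ s t = quadraticPeriod ψ 1 t + quadraticPeriod ψ (-1) t +
      (quadraticPeriod φ 1 s * quadraticPeriod ψ (-1) t +
        quadraticPeriod φ (-1) s * quadraticPeriod ψ 1 t) := by
  unfold whitemanSum quadraticPeriod
  rw [whitemanSet_eq, sum_union, sum_union,
    sum_filter_quadraticChar_add (fun b => ψ (b * t)), sum_mul_sum, sum_mul_sum,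
    ← sum_product', ← sum_product']
  · congr 1
    simp
  · rw [disjoint_left]
    rintro ⟨a, b⟩ h h'
    simp only [mem_product, mem_filter, mem_univ, true_and] at h h'
    rw [h.1] at h'
    norm_num at h'
  · rw [disjoint_left]
    rintro ⟨a, b⟩ h h'
    simp only [mem_product, mem_singleton, mem_filter, mem_univ, true_and, mem_union] at h h'
    simp [h.1] at h'

variable {φ : AddChar K F} {ψ : AddChar L F}

theorem whitemanSum_zero_left (hK : ringChar K ≠ 2) (hψ : ψ ≠ 1) {t : L} (ht : t ≠ 0) :
    whitemanSum φ ψ 0 t = -((Fintype.card K + 1) / 2 : ℕ) := by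
  have h := quadraticPeriod_one_add_neg_one ψ hψ ht
  have hc : (Fintype.card K + 1) / 2 = (Fintype.card K - 1) / 2 + 1 := by
    have := Fintype.card_pos (α := K)
    omega
  rw [whitemanSum_eq, quadraticPeriod_zero φ hK (Or.inl rfl),
    quadraticPeriod_zero φ hK (Or.inr rfl), hc]
  push_cast
  linear_combination (1 + (((Fintype.card K - 1) / 2 : ℕ) : F)) * h

theorem whitemanSum_zero_right (hL : ringChar L ≠ 2) (hφ : φ ≠ 1) {s : K} (hs : s ≠ 0) :
    whitemanSum φ ψ s 0 = ((Fintype.card L - 1) / 2 : ℕ) := by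
  have h := quadraticPeriod_one_add_neg_one φ hφ hs
  rw [whitemanSum_eq, quadraticPeriod_zero ψ hL (Or.inl rfl),
    quadraticPeriod_zero ψ hL (Or.inr rfl)]
  linear_combination (((Fintype.card L - 1) / 2 : ℕ) : F) * h

theorem whitemanSum_of_mul_eq_one {s : K} {t : L}
    (h : quadraticChar K s * quadraticChar L t = 1) :
    whitemanSum φ ψ s t = whitemanSum φ ψ 1 1 := by
  have hs : s ≠ 0 := by rintro rfl; simp at h
  have ht : t ≠ 0 := by rintro rfl; simp at h
  rw [whitemanSum_eq, whitemanSum_eq, quadraticPeriod_of_ne_zero φ 1 hs,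
    quadraticPeriod_of_ne_zero φ (-1) hs, quadraticPeriod_of_ne_zero ψ 1 ht,
    quadraticPeriod_of_ne_zero ψ (-1) ht]
  rcases (quadraticChar_mul_eq_one_iff s t).1 h with ⟨h1, h2⟩ | ⟨h1, h2⟩
  · simp only [h1, h2, mul_one]
  · simp only [h1, h2, mul_one, mul_neg, neg_neg]
    ring

theorem whitemanSum_of_mul_eq_neg_one (hφ : φ ≠ 1) (hψ : ψ ≠ 1) {s : K} {t : L}
    (h : quadraticChar K s * quadraticChar L t = -1) :
    whitemanSum φ ψ s t = -(whitemanSum φ ψ 1 1 + 1) := by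
  have hs : s ≠ 0 := by rintro rfl; simp at h
  have ht : t ≠ 0 := by rintro rfl; simp at h
  have hx := quadraticPeriod_one_add_neg_one φ hφ one_ne_zero
  have hy := quadraticPeriod_one_add_neg_one ψ hψ one_ne_zero
  rw [whitemanSum_eq, whitemanSum_eq, quadraticPeriod_of_ne_zero φ 1 hs,
    quadraticPeriod_of_ne_zero φ (-1) hs, quadraticPeriod_of_ne_zero ψ 1 ht,
    quadraticPeriod_of_ne_zero ψ (-1) ht]
  rcases (quadraticChar_mul_eq_neg_one_iff s t).1 h with ⟨h1, h2⟩ | ⟨h1, h2⟩ <;>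
    simp only [h1, h2, mul_one, mul_neg, neg_neg] <;>
    rw [← eq_sub_iff_add_eq'] at hx hy <;> rw [hx, hy] <;> ring

end WhitemanSum

section PrimitiveRoot

variable {p : ℕ} [Fact p.Prime]

theorem quadraticChar_eq_neg_one_of_orderOf_eq_s10 (hp : Odd p) {x : ZMod p}
    (hx : orderOf x = p - 1) : quadraticChar (ZMod p) x = -1 := by
  have hp2 := (Fact.out : p.Prime).two_le
  obtain ⟨k, hk⟩ := hp
  rw [quadraticChar_neg_one_iff_not_isSquare]
  rintro ⟨b, rfl⟩
  have hb : b ≠ 0 := by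
    rintro rfl
    rw [mul_zero, orderOf_zero] at hx
    omega
  have h1 : (b * b) ^ k = 1 := by
    rw [← sq, ← pow_mul, ← ZMod.pow_card_sub_one_eq_one hb]
    congr 1
    omega
  have := Nat.le_of_dvd (by omega) (orderOf_dvd_of_pow_eq_one h1)
  omega

theorem ZMod.exists_pow_eq_of_orderOf_eq {x y : ZMod p} (hx : orderOf x = p - 1) (hy : y ≠ 0) :
    ∃ k, x ^ k = y := by
  have hp2 := (Fact.out : p.Prime).two_le
  have : NeZero (p - 1) := ⟨by omega⟩
  have hprim : IsPrimitiveRoot x (p - 1) := hx ▸ IsPrimitiveRoot.orderOf x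
  obtain ⟨k, -, hk⟩ := hprim.eq_pow_of_pow_eq_one (ZMod.pow_card_sub_one_eq_one hy)
  exact ⟨k, hk⟩

end PrimitiveRoot

/-- Simultaneous discrete logarithms with respect to the generators of Whiteman's classes. -/
theorem Nat.exists_modEq_add_of_gcd_eq_six {M N : ℕ} (hM : 0 < M) (hN : 0 < N)
    (h6 : Nat.gcd M N = 6) (a b : ℕ) :
    ∃ i < 6, ∃ s < M * N / 6, s + i ≡ a [MOD M] ∧ s ≡ b [MOD N] := by
  obtain ⟨c, rfl⟩ : 6 ∣ M := h6 ▸ Nat.gcd_dvd_left M N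
  have hc : 0 < c := by omega
  have hi : (a + 5 * b) % 6 < 6 := Nat.mod_lt _ (by norm_num)
  set i := (a + 5 * b) % 6 with hidef
  have hci : i ≤ c * i := Nat.le_mul_of_pos_left i hc
  have hcong : a + 6 * (c * i) - i ≡ b [MOD Nat.gcd (6 * c) N] := by
    rw [h6]
    unfold Nat.ModEq
    omega
  refine ⟨i, hi, Nat.chineseRemainder' hcong, ?_, ?_, (Nat.chineseRemainder' hcong).2.2⟩
  · have := Nat.chineseRemainder'_lt_lcm hcong hM.ne' hN.ne'
    rwa [Nat.lcm, h6] at this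
  · have h1 := (Nat.chineseRemainder' hcong).2.1.add_right i
    refine h1.trans ?_
    have h2 : a + 6 * (c * i) - i + i = a + 6 * c * i := by
      have := mul_assoc 6 c i
      omega
    rw [h2]
    simp [Nat.ModEq]

section ChineseRemainder

variable {n₁ n₂ : ℕ} [Fact n₁.Prime] [Fact n₂.Prime]

theorem ZMod.exists_eq_pow_mul_pow (hcop : n₁.Coprime n₂)
    (h6 : Nat.gcd (n₁ - 1) (n₂ - 1) = 6) {g u : ℕ}
    (hg₁ : orderOf (g : ZMod n₁) = n₁ - 1) (hg₂ : orderOf (g : ZMod n₂) = n₂ - 1)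
    (hu₁ : (u : ZMod n₁) = (g : ZMod n₁)) (hu₂ : (u : ZMod n₂) = 1) {x : ZMod (n₁ * n₂)}
    (hx₁ : (ZMod.chineseRemainder hcop x).1 ≠ 0) (hx₂ : (ZMod.chineseRemainder hcop x).2 ≠ 0) :
    ∃ i < 6, ∃ s < (n₁ - 1) * (n₂ - 1) / 6,
      x = (g : ZMod (n₁ * n₂)) ^ s * (u : ZMod (n₁ * n₂)) ^ i := by
  have hp₁ := (Fact.out : n₁.Prime).two_le
  have hp₂ := (Fact.out : n₂.Prime).two_le
  obtain ⟨a, ha⟩ := ZMod.exists_pow_eq_of_orderOf_eq hg₁ hx₁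
  obtain ⟨b, hb⟩ := ZMod.exists_pow_eq_of_orderOf_eq hg₂ hx₂
  obtain ⟨i, hi, s, hs, h1, h2⟩ :=
    Nat.exists_modEq_add_of_gcd_eq_six (by omega) (by omega) h6 a b
  refine ⟨i, hi, s, hs, (ZMod.chineseRemainder hcop).injective (Prod.ext ?_ ?_)⟩
  · rw [← ha, map_mul, map_pow, map_pow, map_natCast, map_natCast, Prod.fst_mul, Prod.pow_fst,
      Prod.pow_fst, Prod.fst_natCast, Prod.fst_natCast, hu₁, ← pow_add]
    exact pow_eq_pow_of_modEq h1.symm (hg₁ ▸ pow_orderOf_eq_one _)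
  · rw [← hb, map_mul, map_pow, map_pow, map_natCast, map_natCast, Prod.snd_mul, Prod.pow_snd,
      Prod.pow_snd, Prod.snd_natCast, Prod.snd_natCast, hu₂, one_pow, mul_one]
    exact pow_eq_pow_of_modEq h2.symm (hg₂ ▸ pow_orderOf_eq_one _)

theorem quadraticChar_mul_pow_mul_pow (hcop : n₁.Coprime n₂) (hodd₁ : Odd n₁) (hodd₂ : Odd n₂)
    {g u : ℕ} (hg₁ : orderOf (g : ZMod n₁) = n₁ - 1) (hg₂ : orderOf (g : ZMod n₂) = n₂ - 1)
    (hu₁ : (u : ZMod n₁) = (g : ZMod n₁)) (hu₂ : (u : ZMod n₂) = 1) (s i : ℕ) :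
    quadraticChar (ZMod n₁) (ZMod.chineseRemainder hcop
        ((g : ZMod (n₁ * n₂)) ^ s * (u : ZMod (n₁ * n₂)) ^ i)).1 *
      quadraticChar (ZMod n₂) (ZMod.chineseRemainder hcop
        ((g : ZMod (n₁ * n₂)) ^ s * (u : ZMod (n₁ * n₂)) ^ i)).2 = (-1) ^ i := by
  rw [map_mul, map_pow, map_pow, map_natCast, map_natCast, Prod.fst_mul, Prod.snd_mul,
    Prod.pow_fst, Prod.pow_fst, Prod.pow_snd, Prod.pow_snd, Prod.fst_natCast, Prod.fst_natCast,
    Prod.snd_natCast, Prod.snd_natCast, hu₁, hu₂, map_mul, map_mul, map_pow, map_pow, map_pow,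
    one_pow, map_one, quadraticChar_eq_neg_one_of_orderOf_eq_s10 hodd₁ hg₁,
    quadraticChar_eq_neg_one_of_orderOf_eq_s10 hodd₂ hg₂, mul_one, mul_right_comm, ← mul_pow]
  norm_num

theorem ZMod.exists_natCast_mul_left_iff (hcop : n₁.Coprime n₂) (x : ZMod (n₁ * n₂)) :
    (∃ k : ℕ, 1 ≤ k ∧ k ≤ n₂ - 1 ∧ x = ((k * n₁ : ℕ) : ZMod (n₁ * n₂))) ↔
      (ZMod.chineseRemainder hcop x).1 = 0 ∧ (ZMod.chineseRemainder hcop x).2 ≠ 0 := by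
  have hp₁ := (Fact.out : n₁.Prime)
  have hp₂ := (Fact.out : n₂.Prime)
  constructor
  · rintro ⟨k, hk, hk', rfl⟩
    rw [map_natCast, Prod.fst_natCast, Prod.snd_natCast]
    refine ⟨by simp, ?_⟩
    rw [Ne, ZMod.natCast_eq_zero_iff]
    intro h
    have := Nat.le_of_dvd hk (hcop.symm.dvd_of_dvd_mul_right h)
    omega
  · rintro ⟨h1, h2⟩
    have : NeZero (n₁ * n₂) := ⟨mul_ne_zero hp₁.ne_zero hp₂.ne_zero⟩
    obtain ⟨v, hv, rfl⟩ : ∃ v < n₁ * n₂, (v : ZMod (n₁ * n₂)) = x :=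
      ⟨x.val, x.val_lt, ZMod.natCast_zmod_val x⟩
    rw [map_natCast, Prod.fst_natCast, ZMod.natCast_eq_zero_iff] at h1
    rw [map_natCast, Prod.snd_natCast] at h2
    obtain ⟨k, rfl⟩ := h1
    refine ⟨k, Nat.one_le_iff_ne_zero.2 ?_, ?_, by rw [mul_comm n₁ k]⟩
    · rintro rfl
      simp at h2
    · have := Nat.lt_of_mul_lt_mul_left hv
      omega

theorem ZMod.exists_natCast_mul_right_iff (hcop : n₁.Coprime n₂) (x : ZMod (n₁ * n₂)) :
    (∃ k : ℕ, 1 ≤ k ∧ k ≤ n₁ - 1 ∧ x = ((k * n₂ : ℕ) : ZMod (n₁ * n₂))) ↔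
      (ZMod.chineseRemainder hcop x).1 ≠ 0 ∧ (ZMod.chineseRemainder hcop x).2 = 0 := by
  have hp₁ := (Fact.out : n₁.Prime)
  have hp₂ := (Fact.out : n₂.Prime)
  constructor
  · rintro ⟨k, hk, hk', rfl⟩
    rw [map_natCast, Prod.fst_natCast, Prod.snd_natCast]
    refine ⟨?_, by simp⟩
    rw [Ne, ZMod.natCast_eq_zero_iff]
    intro h
    have := Nat.le_of_dvd hk (hcop.dvd_of_dvd_mul_right h)
    omega
  · rintro ⟨h1, h2⟩
    have : NeZero (n₁ * n₂) := ⟨mul_ne_zero hp₁.ne_zero hp₂.ne_zero⟩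
    obtain ⟨v, hv, rfl⟩ : ∃ v < n₁ * n₂, (v : ZMod (n₁ * n₂)) = x :=
      ⟨x.val, x.val_lt, ZMod.natCast_zmod_val x⟩
    rw [map_natCast, Prod.snd_natCast, ZMod.natCast_eq_zero_iff] at h2
    rw [map_natCast, Prod.fst_natCast] at h1
    obtain ⟨k, rfl⟩ := h2
    refine ⟨k, Nat.one_le_iff_ne_zero.2 ?_, ?_, by rw [mul_comm n₂ k]⟩
    · rintro rfl
      simp at h1
    · rw [mul_comm] at hv
      have := Nat.lt_of_mul_lt_mul_right hv
      omega

theorem exists_addChar_pow_val_eq (hcop : n₁.Coprime n₂) {F : Type*} [Field F] {β : F}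
    (hβ : IsPrimitiveRoot β (n₁ * n₂)) :
    ∃ (φ : AddChar (ZMod n₁) F) (ψ : AddChar (ZMod n₂) F), φ ≠ 1 ∧ ψ ≠ 1 ∧
      ∀ x : ZMod (n₁ * n₂), β ^ x.val =
        φ (ZMod.chineseRemainder hcop x).1 * ψ (ZMod.chineseRemainder hcop x).2 := by
  have hp₁ := (Fact.out : n₁.Prime)
  have hp₂ := (Fact.out : n₂.Prime)
  have : NeZero (n₁ * n₂) := ⟨mul_ne_zero hp₁.ne_zero hp₂.ne_zero⟩
  set E := ZMod.chineseRemainder hcop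
  set χ := AddChar.zmodChar (n₁ * n₂) hβ.pow_eq_one
  have hχ : ∀ x, χ x = 1 → x = 0 := by
    intro x hx
    rw [AddChar.zmodChar_apply, ← pow_zero β] at hx
    exact (ZMod.val_eq_zero x).1 (hβ.pow_inj x.val_lt (NeZero.pos _) hx)
  refine ⟨χ.compAddMonoidHom (E.symm.toAddMonoidHom.comp (AddMonoidHom.inl _ _)),
    χ.compAddMonoidHom (E.symm.toAddMonoidHom.comp (AddMonoidHom.inr _ _)), ?_, ?_, ?_⟩
  · intro h
    have h1 : E.symm (1, 0) = 0 := hχ _ (DFunLike.congr_fun h 1)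
    rw [map_eq_zero_iff _ E.symm.injective] at h1
    exact one_ne_zero (congrArg Prod.fst h1)
  · intro h
    have h1 : E.symm (0, 1) = 0 := hχ _ (DFunLike.congr_fun h 1)
    rw [map_eq_zero_iff _ E.symm.injective] at h1
    exact one_ne_zero (congrArg Prod.snd h1)
  · intro x
    change χ x = χ (E.symm ((E x).1, 0)) * χ (E.symm (0, (E x).2))
    rw [← AddChar.map_add_eq_mul, ← map_add]
    simp

end ChineseRemainder

theorem stmt_10
    (n₁ n₂ n e g u : ℕ)
    (hp₁ : n₁.Prime) (hp₂ : n₂.Prime)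
    (hodd₁ : Odd n₁) (hodd₂ : Odd n₂) (hne : n₁ ≠ n₂)
    (h6 : Nat.gcd (n₁ - 1) (n₂ - 1) = 6)
    (hn : n = n₁ * n₂)
    (he : e = (n₁ - 1) * (n₂ - 1) / 6)
    (hg₁ : orderOf (g : ZMod n₁) = n₁ - 1)
    (hg₂ : orderOf (g : ZMod n₂) = n₂ - 1)
    (hu₁ : (u : ZMod n₁) = (g : ZMod n₁))
    (hu₂ : (u : ZMod n₂) = 1)
    (W : ℕ → Finset (ZMod n))
    (hW : ∀ i, (W i : Set (ZMod n)) =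
      {x | ∃ s < e, x = (g : ZMod n) ^ s * (u : ZMod n) ^ i})
    (P Q : Set (ZMod n))
    (hP : P = {x | ∃ k : ℕ, 1 ≤ k ∧ k ≤ n₂ - 1 ∧ x = ((k * n₁ : ℕ) : ZMod n)})
    (hQ : Q = {x | ∃ k : ℕ, 1 ≤ k ∧ k ≤ n₁ - 1 ∧ x = ((k * n₂ : ℕ) : ZMod n)})
    (D₀ D₁ : Set (ZMod n))
    (hD₀ : D₀ = ↑(W 0) ∪ ↑(W 2) ∪ ↑(W 4)) (hD₁ : D₁ = ↑(W 1) ∪ ↑(W 3) ∪ ↑(W 5))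
    (p a q m : ℕ) (hp : p.Prime) (ha : 0 < a) (hq : q = p ^ a)
    (hco : Nat.Coprime n q) (hm : m = orderOf (q : ZMod n))
    (F : Type) [Field F] [Fintype F] [CharP F p]
    (hF : Fintype.card F = q ^ m)
    (β : F) (hβ : IsPrimitiveRoot β n)
    (C₁ : Finset (ZMod n))
    (hC₁ : (C₁ : Set (ZMod n)) = P ∪ ↑(W 1) ∪ ↑(W 3) ∪ ↑(W 5)) :
    ∀ t : ZMod n,
      (t ∈ P → ∑ i ∈ C₁, β ^ (i * t).val = -(((n₁ + 1) / 2 : ℕ) : F)) ∧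
      (t ∈ Q → ∑ i ∈ C₁, β ^ (i * t).val = (((n₂ - 1) / 2 : ℕ) : F)) ∧
      (t ∈ D₀ → ∑ i ∈ C₁, β ^ (i * t).val = ∑ i ∈ C₁, β ^ i.val) ∧
      (t ∈ D₁ → ∑ i ∈ C₁, β ^ (i * t).val = -((∑ i ∈ C₁, β ^ i.val) + 1)) := by
  have : Fact n₁.Prime := ⟨hp₁⟩
  have : Fact n₂.Prime := ⟨hp₂⟩
  have hcop : n₁.Coprime n₂ := (Nat.coprime_primes hp₁ hp₂).2 hne
  subst hn he
  have hK : ringChar (ZMod n₁) ≠ 2 := by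
    rw [ZMod.ringChar_zmod_n]
    rintro rfl
    exact absurd hodd₁ (by decide)
  have hL : ringChar (ZMod n₂) ≠ 2 := by
    rw [ZMod.ringChar_zmod_n]
    rintro rfl
    exact absurd hodd₂ (by decide)
  obtain ⟨φ, ψ, hφ, hψ, hpow⟩ := exists_addChar_pow_val_eq hcop hβ
  set E := ZMod.chineseRemainder hcop
  have hWmem : ∀ i x, x ∈ W i ↔ ∃ s < (n₁ - 1) * (n₂ - 1) / 6,
      x = (g : ZMod (n₁ * n₂)) ^ s * (u : ZMod (n₁ * n₂)) ^ i := fun i x => by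
    rw [← Finset.mem_coe, hW]
    rfl
  have hWchar : ∀ i x, x ∈ W i →
      quadraticChar (ZMod n₁) (E x).1 * quadraticChar (ZMod n₂) (E x).2 = (-1) ^ i := by
    intro i x hx
    obtain ⟨s, -, rfl⟩ := (hWmem i x).1 hx
    exact quadraticChar_mul_pow_mul_pow hcop hodd₁ hodd₂ hg₁ hg₂ hu₁ hu₂ s i
  have hWex : ∀ x, quadraticChar (ZMod n₁) (E x).1 * quadraticChar (ZMod n₂) (E x).2 ≠ 0 →
      ∃ i < 6, x ∈ W i := by
    intro x hx
    obtain ⟨i, hi, h⟩ := ZMod.exists_eq_pow_mul_pow hcop h6 hg₁ hg₂ hu₁ hu₂ (x := x)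
      (fun h => hx (by simp [E, h])) (fun h => hx (by simp [E, h]))
    exact ⟨i, hi, (hWmem i x).2 h⟩
  have hD₀char : ∀ x ∈ D₀,
      quadraticChar (ZMod n₁) (E x).1 * quadraticChar (ZMod n₂) (E x).2 = 1 := by
    intro x hx
    rw [hD₀] at hx
    rcases hx with (hx | hx) | hx <;> simpa only [even_two, Even.neg_pow, one_pow, pow_zero,
      show Even 4 from ⟨2, rfl⟩] using hWchar _ _ hx
  have hD₁char : ∀ x, x ∈ D₁ ↔
      quadraticChar (ZMod n₁) (E x).1 * quadraticChar (ZMod n₂) (E x).2 = -1 := by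
    intro x
    rw [hD₁]
    constructor
    · rintro ((hx | hx) | hx) <;> rw [hWchar _ _ hx] <;> norm_num
    · intro hx
      obtain ⟨i, hi, hxi⟩ := hWex x (by rw [hx]; norm_num)
      have hpar := (hWchar i x hxi).symm.trans hx
      interval_cases i
      · norm_num at hpar
      · exact Or.inl (Or.inl hxi)
      · norm_num at hpar
      · exact Or.inl (Or.inr hxi)
      · norm_num at hpar
      · exact Or.inr hxi
  have hPchar : ∀ x, x ∈ P ↔ (E x).1 = 0 ∧ (E x).2 ≠ 0 := by
    intro x
    rw [hP]
    exact ZMod.exists_natCast_mul_left_iff hcop x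
  have hQchar : ∀ x, x ∈ Q ↔ (E x).1 ≠ 0 ∧ (E x).2 = 0 := by
    intro x
    rw [hQ]
    exact ZMod.exists_natCast_mul_right_iff hcop x
  have hC₁char : ∀ x, x ∈ C₁ ↔ E x ∈ whitemanSet (ZMod n₁) (ZMod n₂) := by
    intro x
    have hunion : (C₁ : Set (ZMod (n₁ * n₂))) = P ∪ D₁ := by
      rw [hC₁, hD₁]
      simp only [Set.union_assoc]
    rw [← Finset.mem_coe, hunion, Set.mem_union, hPchar, hD₁char]
    simp only [whitemanSet, Finset.mem_filter, Finset.mem_univ, true_and]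
  have hsum : ∀ t, ∑ i ∈ C₁, β ^ (i * t).val = whitemanSum φ ψ (E t).1 (E t).2 := by
    intro t
    unfold whitemanSum
    refine Finset.sum_equiv E.toEquiv hC₁char fun i _ => ?_
    rw [hpow, map_mul]
    rfl
  have hsum1 : ∑ i ∈ C₁, β ^ i.val = whitemanSum φ ψ 1 1 := by
    simpa using hsum 1
  intro t
  rw [hsum, hsum1]
  refine ⟨fun ht => ?_, fun ht => ?_, fun ht => ?_, fun ht => ?_⟩
  · obtain ⟨h1, h2⟩ := (hPchar t).1 ht
    rw [h1, whitemanSum_zero_left hK hψ h2, ZMod.card]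
  · obtain ⟨h1, h2⟩ := (hQchar t).1 ht
    rw [h2, whitemanSum_zero_right hL hφ h1, ZMod.card]
  · exact whitemanSum_of_mul_eq_one (hD₀char t ht)
  · exact whitemanSum_of_mul_eq_neg_one hφ hψ ((hD₁char t).1 ht)
end
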